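/- Let p, q, α_r, β_r, a_r, b_r, g and κ be as in the definition of the generalised Wright function, and assume additionally that 0 < κ < 2 and that Re(a_r) > 0 for every 1 ≤ r ≤ p. Fix a real number c with 0 < c < min_{1≤r≤p} Re(a_r)/α_r. Then for every nonzero complex number w with |arg w| < π(1 − κ/2) (principal argument and principal powers of w), the Mellin–Barnes representation holds: ₚΨ_q(−w) = (1/(2π)) ∫_{−∞}^{∞} Γ(c + i t) · g(−(c + i t)) · w^{−(c + i t)} dt, where the integrand is absolutely integrable over t ∈ ℝ. -/

import Mathlib

open Filter Topology

/-- The function `g(s)` of the generalised Wright function, extended to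
complex argument `s`. -/
noncomputable def wrightCoeff (p q : ℕ) (α : Fin p → ℝ) (a : Fin p → ℂ)
    (β : Fin q → ℝ) (b : Fin q → ℂ) (s : ℂ) : ℂ :=
  (∏ r, Complex.Gamma ((α r : ℂ) * s + a r)) /
    ∏ r, Complex.Gamma ((β r : ℂ) * s + b r)


noncomputable def stE (x y : ℝ) : ℝ :=
  x * (Real.log (x ^ 2 + y ^ 2) / 2) - y * Real.arctan (y / x)

lemma stE_deriv_x {x : ℝ} (hx : 0 < x) (y : ℝ) :
    HasDerivAt (fun t => stE t y) (Real.log (x ^ 2 + y ^ 2) / 2 + 1) x := by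
  have h1 : 0 < x ^ 2 + y ^ 2 := by positivity
  have h2 : HasDerivAt (fun t : ℝ => t ^ 2 + y ^ 2) (2 * x) x := by
    simpa using (hasDerivAt_pow 2 x).add_const (y ^ 2)
  have h3 := (h2.log h1.ne').div_const 2
  have h4 := (hasDerivAt_id x).mul h3
  have h5 : HasDerivAt (fun t : ℝ => y / t) (-y / x ^ 2) x := by
    have := (hasDerivAt_inv hx.ne').const_mul y
    simp only [← div_eq_mul_inv] at this
    exact this.congr_deriv (by ring)
  have h6 := (h5.arctan).const_mul y
  refine (h4.sub h6).congr_deriv ?_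
  have h7 : 1 + (y / x) ^ 2 = (x ^ 2 + y ^ 2) / x ^ 2 := by field_simp
  simp only [id]
  rw [h7]
  field_simp
  ring

lemma stE_deriv_y {x : ℝ} (hx : 0 < x) (y : ℝ) :
    HasDerivAt (fun t => stE x t) (-Real.arctan (y / x)) y := by
  have h1 : 0 < x ^ 2 + y ^ 2 := by positivity
  have h2 : HasDerivAt (fun t : ℝ => x ^ 2 + t ^ 2) (2 * y) y := by
    simpa using (hasDerivAt_pow 2 y).const_add (x ^ 2)
  have h3 := ((h2.log h1.ne').div_const 2).const_mul x
  have h5 : HasDerivAt (fun t : ℝ => t / x) (1 / x) y := (hasDerivAt_id y).div_const x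
  have h6 := (hasDerivAt_id y).mul (h5.arctan)
  refine (h3.sub h6).congr_deriv ?_
  have h7 : 1 + (y / x) ^ 2 = (x ^ 2 + y ^ 2) / x ^ 2 := by field_simp
  simp only [id]
  rw [h7]
  field_simp
  ring

noncomputable def stPsi (y t : ℝ) : ℝ := Real.log (t ^ 2 + y ^ 2) / 2 - Real.log t
noncomputable def stPhi (y t : ℝ) : ℝ := stE t y - t * Real.log t

lemma stPhi_deriv {t : ℝ} (ht : 0 < t) (y : ℝ) : HasDerivAt (stPhi y) (stPsi y t) t := by
  have h := (stE_deriv_x ht y).sub ((hasDerivAt_id t).mul (Real.hasDerivAt_log ht.ne'))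
  refine h.congr_deriv ?_
  simp only [id, stPsi]
  field_simp
  ring

lemma stPsi_eq {t : ℝ} (ht : 0 < t) (y : ℝ) :
    stPsi y t = Real.log (1 + (y / t) ^ 2) / 2 := by
  have h7 : t ^ 2 + y ^ 2 = t ^ 2 * (1 + (y / t) ^ 2) := by field_simp
  rw [stPsi, h7, Real.log_mul (by positivity) (by positivity), Real.log_pow]
  push_cast; ring

lemma stPsi_anti {s t : ℝ} (hs : 0 < s) (hst : s ≤ t) (y : ℝ) : stPsi y t ≤ stPsi y s := by
  rw [stPsi_eq hs, stPsi_eq (hs.trans_le hst)]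
  have h : (y / t) ^ 2 ≤ (y / s) ^ 2 := by
    rw [div_pow, div_pow]
    gcongr
  have := Real.log_le_log (by positivity) (by linarith : 1 + (y / t) ^ 2 ≤ 1 + (y / s) ^ 2)
  linarith

lemma stPhi_step {t : ℝ} (ht : 0 < t) (y : ℝ) :
    stPsi y (t + 1) ≤ stPhi y (t + 1) - stPhi y t ∧
      stPhi y (t + 1) - stPhi y t ≤ stPsi y t := by
  obtain ⟨c, hc, h⟩ := exists_hasDerivAt_eq_slope (stPhi y) (stPsi y) (lt_add_one t)
    (fun x hx => (stPhi_deriv (ht.trans_le hx.1) y).continuousAt.continuousWithinAt)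
    (fun x hx => stPhi_deriv (ht.trans hx.1) y)
  have h2 : stPhi y (t + 1) - stPhi y t = stPsi y c := by rw [h]; simp
  rw [h2]
  exact ⟨stPsi_anti (ht.trans hc.1) hc.2.le y, stPsi_anti ht hc.1.le y⟩

lemma stPhi_sum {x : ℝ} (hx : 0 < x) (y : ℝ) (n : ℕ) :
    stPhi y (x + (n + 1 : ℕ)) - stPhi y x ≤ ∑ k ∈ Finset.range (n + 1), stPsi y (x + k) ∧
    ∑ k ∈ Finset.range (n + 1), stPsi y (x + k) ≤
      stPsi y x + (stPhi y (x + n) - stPhi y x) := by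
  induction n with
  | zero =>
    have := stPhi_step hx y
    simp
    simp at this
    linarith [this.2]
  | succ n ih =>
    have h1 := stPhi_step (show 0 < x + (n + 1 : ℕ) by positivity) y
    have h2 := stPhi_step (show 0 < x + n by positivity) y
    rw [Finset.sum_range_succ]
    push_cast at *
    rw [add_assoc x n 1] at h2
    rw [add_assoc x (n+1) 1] at h1
    constructor <;> linarith [h1.1, h1.2, h2.1, h2.2, ih.1, ih.2]

lemma stPhi_tendsto (y : ℝ) : Tendsto (stPhi y) atTop (𝓝 0) := by
  have h0 : Tendsto (fun t : ℝ => y / t) atTop (𝓝 0) := tendsto_const_nhds.div_atTop tendsto_id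
  have h1 : Tendsto (fun t : ℝ => y * Real.arctan (y / t)) atTop (𝓝 0) := by
    have := (Real.continuous_arctan.tendsto 0).comp h0
    simpa using this.const_mul y
  have h2 : Tendsto (fun t : ℝ => t * stPsi y t) atTop (𝓝 0) := by
    have h3 : Tendsto (fun t : ℝ => y ^ 2 / t) atTop (𝓝 0) :=
      tendsto_const_nhds.div_atTop tendsto_id
    refine squeeze_zero' ?_ ?_ h3
    · filter_upwards [eventually_gt_atTop 0] with t ht
      rw [stPsi_eq ht]
      have : 0 ≤ Real.log (1 + (y / t) ^ 2) := Real.log_nonneg (by nlinarith [sq_nonneg (y/t)])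
      positivity
    · filter_upwards [eventually_gt_atTop 0] with t ht
      rw [stPsi_eq ht]
      have : Real.log (1 + (y / t) ^ 2) ≤ (y / t) ^ 2 := by
        have := Real.log_le_sub_one_of_pos (show 0 < 1 + (y / t) ^ 2 by positivity)
        linarith
      have h4 : t * (y / t) ^ 2 = y ^ 2 / t := by field_simp
      have h5 : 0 ≤ y ^ 2 / t := by positivity
      have h6 := mul_le_mul_of_nonneg_left this ht.le
      rw [h4] at h6
      linarith
  have h3 := h2.sub h1
  simp only [sub_zero] at h3
  refine h3.congr fun t => ?_
  simp only [stPhi, stE, stPsi]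
  ring

lemma GammaSeq_log {x : ℝ} (hx : 0 < x) (y : ℝ) {n : ℕ} (hn : n ≠ 0) :
    Real.log ‖Complex.GammaSeq (x + y * Complex.I) n‖ =
      Real.log (Real.GammaSeq x n) - ∑ k ∈ Finset.range (n + 1), stPsi y (x + k) := by
  have hn' : (0 : ℝ) < n := by positivity
  have hz : ∀ k : ℕ, 0 < ‖(x + y * Complex.I : ℂ) + k‖ := fun k => by
    rw [norm_pos_iff]
    intro h
    have := congrArg Complex.re h
    simp at this
    have h2 : (0 : ℝ) ≤ k := by positivity
    linarith
  have hzl : ∀ k : ℕ, Real.log ‖(x + y * Complex.I : ℂ) + k‖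
      = Real.log (x + k) + stPsi y (x + k) := fun k => by
    rw [stPsi, Complex.norm_eq_sqrt_sq_add_sq, Real.log_sqrt (by positivity)]
    simp
  have hpow : ‖(n : ℂ) ^ (x + y * Complex.I : ℂ)‖ = (n : ℝ) ^ x := by
    have := Complex.norm_cpow_eq_rpow_re_of_pos hn' (x + y * Complex.I)
    simpa using this
  rw [Complex.GammaSeq, Real.GammaSeq, norm_div, norm_mul, hpow, norm_prod, Complex.norm_natCast]
  have hf : (0 : ℝ) < n.factorial := by positivity
  rw [Real.log_div (by positivity) (Finset.prod_pos fun k _ => hz k).ne',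
    Real.log_div (by positivity) (Finset.prod_pos fun k _ => by positivity).ne',
    Real.log_prod (fun k _ => (hz k).ne'), Real.log_prod (fun k _ => by positivity)]
  simp only [hzl, Finset.sum_add_distrib]
  ring

lemma Gamma_norm_bounds {x : ℝ} (hx : 0 < x) (y : ℝ) :
    Real.log ‖Complex.Gamma (x + y * Complex.I)‖ ≤ Real.log (Real.Gamma x) + stPhi y x ∧
    Real.log (Real.Gamma x) + stPhi y x - stPsi y x
      ≤ Real.log ‖Complex.Gamma (x + y * Complex.I)‖ := by
  have h1 : Tendsto (fun n => Real.log ‖Complex.GammaSeq (x + y * Complex.I) n‖) atTop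
      (𝓝 (Real.log ‖Complex.Gamma (x + y * Complex.I)‖)) := by
    have : Complex.Gamma (x + y * Complex.I) ≠ 0 :=
      Complex.Gamma_ne_zero_of_re_pos (by simpa using hx)
    exact ((Complex.GammaSeq_tendsto_Gamma _).norm).log (by simpa using this)
  have h2 := (Real.GammaSeq_tendsto_Gamma x).log (Real.Gamma_pos_of_pos hx).ne'
  have hcast : Tendsto (fun n : ℕ => x + (n : ℝ)) atTop atTop :=
    tendsto_atTop_add_const_left _ _ tendsto_natCast_atTop_atTop
  have h3 := (stPhi_tendsto y).comp hcast
  have h4 := h3.comp (tendsto_add_atTop_nat 1)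
  constructor
  · have h5 := h2.sub (h4.sub_const (stPhi y x))
    refine (le_of_tendsto_of_tendsto h1 h5 ?_).trans (by linarith)
    filter_upwards [eventually_ne_atTop 0] with n hn
    rw [GammaSeq_log hx y hn]
    have := (stPhi_sum hx y n).1
    simp only [Function.comp]
    linarith
  · have h5 := h2.sub ((h3.sub_const (stPhi y x)).const_add (stPsi y x))
    refine le_trans (by linarith) (le_of_tendsto_of_tendsto h5 h1 ?_)
    filter_upwards [eventually_ne_atTop 0] with n hn
    rw [GammaSeq_log hx y hn]
    have := (stPhi_sum hx y n).2
    simp only [Function.comp]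
    linarith

lemma log_one_add_le {ε s : ℝ} (hε : 0 < ε) (hs : 0 ≤ s) :
    Real.log (1 + s) ≤ ε * s + (ε + |Real.log ε|) := by
  have h1 : Real.log (ε * (1 + s)) ≤ ε * (1 + s) - 1 :=
    Real.log_le_sub_one_of_pos (by positivity)
  rw [Real.log_mul hε.ne' (by positivity)] at h1
  have := neg_abs_le (Real.log ε)
  linarith

lemma xlogx_step {x : ℝ} (hx : 0 < x) :
    x * Real.log x ≤ (x + 1) * Real.log (x + 1) ∧
    (x + 1) * Real.log (x + 1) ≤ x * Real.log x + (x + 1) := by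
  have h0 : Real.log (x + 1) = Real.log x + Real.log (1 + 1 / x) := by
    rw [← Real.log_mul hx.ne' (by positivity)]
    congr 1
    field_simp
  have h1 : 0 ≤ Real.log (1 + 1 / x) := Real.log_nonneg (by simp [hx.le])
  have h2 : Real.log (1 + 1 / x) ≤ 1 / x := by
    have := Real.log_le_sub_one_of_pos (show 0 < 1 + 1 / x by positivity)
    linarith
  have h3 : 0 ≤ Real.log (x + 1) := Real.log_nonneg (by linarith)
  have h4 : Real.log (x + 1) ≤ x := by
    have := Real.log_le_sub_one_of_pos (show 0 < x + 1 by positivity)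
    linarith
  have h5 : x * Real.log (1 + 1 / x) ≤ 1 := by
    have := mul_le_mul_of_nonneg_left h2 hx.le
    rwa [mul_one_div_cancel hx.ne'] at this
  have h6 := mul_nonneg hx.le h1
  have h7 : (x + 1) * Real.log (x + 1) =
    x * Real.log x + x * Real.log (1 + 1 / x) + Real.log (x + 1) := by
    rw [add_mul, one_mul]; nth_rw 1 [h0]; ring
  rw [h7]
  constructor <;> linarith

lemma log_fac_le (m : ℕ) (hm : m ≠ 0) : Real.log (m.factorial) ≤ m * Real.log m := by
  rw [← Real.log_pow]
  apply Real.log_le_log (by positivity)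
  exact_mod_cast Nat.factorial_le_pow m

lemma le_log_fac (m : ℕ) (hm : m ≠ 0) : m * Real.log m - m ≤ Real.log (m.factorial) := by
  have h := Stirling.le_log_factorial_stirling hm
  have h1 : 0 ≤ Real.log m := Real.log_natCast_nonneg m
  have h2 : 0 ≤ Real.log (2 * Real.pi) := Real.log_nonneg (by linarith [Real.two_le_pi])
  linarith

lemma real_Gamma_bounds {x : ℝ} (hx : 0 < x) :
    x * Real.log x - (x + 1) ≤ Real.log (Real.Gamma (x + 2)) ∧
    Real.log (Real.Gamma (x + 2)) ≤ x * Real.log x + (2 * x + 3) := by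
  have hG : 0 < Real.Gamma (x + 2) := Real.Gamma_pos_of_pos (by linarith)
  have hfac : ∀ n : ℕ, Real.Gamma ((n : ℝ) + 2) = (n + 1).factorial := fun n => by
    rw [← Real.Gamma_nat_eq_factorial]; push_cast; congr 1; ring
  constructor
  · set m := ⌊x⌋₊
    have h1 : (m : ℝ) ≤ x := Nat.floor_le hx.le
    have h2 : x < m + 1 := Nat.lt_floor_add_one x
    have h3 : Real.Gamma ((m : ℝ) + 2) ≤ Real.Gamma (x + 2) :=
      Real.Gamma_strictMonoOn_Ici.monotoneOn (by simp) (by simpa using hx.le) (by linarith)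
    rw [hfac] at h3
    have h4 := Real.log_le_log (by positivity) h3
    have h5 := le_log_fac (m + 1) (by omega)
    push_cast at h5
    have h6 : x * Real.log x ≤ (m + 1) * Real.log (m + 1) := by
      have h8 : 0 ≤ Real.log ((m : ℝ) + 1) := Real.log_nonneg (by simp)
      have h7 : Real.log x ≤ Real.log (m + 1) := Real.log_le_log hx h2.le
      calc x * Real.log x ≤ x * Real.log (m + 1) := by gcongr
        _ ≤ _ := by gcongr
    linarith
  · set m := ⌈x⌉₊
    have h1 : x ≤ m := Nat.le_ceil x
    have h2 : (m : ℝ) < x + 1 := Nat.ceil_lt_add_one hx.le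
    have h3 : Real.Gamma (x + 2) ≤ Real.Gamma ((m : ℝ) + 2) :=
      Real.Gamma_strictMonoOn_Ici.monotoneOn (by simpa using hx.le) (by simp) (by linarith)
    rw [hfac] at h3
    have h4 := Real.log_le_log hG h3
    have h5 := log_fac_le (m + 1) (by omega)
    push_cast at h5
    have h6 : ((m : ℝ) + 1) * Real.log (m + 1) ≤ (x + 1 + 1) * Real.log (x + 1 + 1) := by
      have h8 : 0 ≤ Real.log ((m : ℝ) + 1) := Real.log_nonneg (by simp)
      gcongr
    have h7 := (xlogx_step hx).2
    have h8 := (xlogx_step (show 0 < x + 1 by linarith)).2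
    linarith

lemma abs_log_le {η x : ℝ} (hη : 0 < η) (hx : η ≤ x) : |Real.log x| ≤ x + |Real.log η| := by
  have h1 := Real.log_le_log hη hx
  have h2 := Real.log_le_sub_one_of_pos (hη.trans_le hx)
  have h3 := neg_abs_le (Real.log η)
  have h4 := abs_nonneg (Real.log η)
  rw [abs_le]
  constructor <;> linarith

lemma real_stirling {η : ℝ} (hη : 0 < η) : ∃ C : ℝ, 0 ≤ C ∧ ∀ x, η ≤ x →
    |Real.log (Real.Gamma x) - x * Real.log x| ≤ C * (x + 1) := by
  refine ⟨6 + |Real.log η|, by positivity, fun x hx => ?_⟩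
  have hx0 : 0 < x := hη.trans_le hx
  have h1 : Real.Gamma (x + 2) = (x + 1) * (x * Real.Gamma x) := by
    rw [← Real.Gamma_add_one hx0.ne', ← Real.Gamma_add_one (by positivity)]
    congr 1; ring
  have hG := Real.Gamma_pos_of_pos hx0
  have h2 : Real.log (Real.Gamma (x + 2)) =
      Real.log (x + 1) + (Real.log x + Real.log (Real.Gamma x)) := by
    rw [h1, Real.log_mul (by positivity) (by positivity), Real.log_mul (by positivity) hG.ne']
  have h3 := real_Gamma_bounds hx0
  have h4 := abs_le.1 (abs_log_le hη hx)
  have h5 : 0 ≤ Real.log (x + 1) := Real.log_nonneg (by linarith)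
  have h6 : Real.log (x + 1) ≤ x := by
    have := Real.log_le_sub_one_of_pos (show 0 < x + 1 by positivity)
    linarith
  have h7 : 0 ≤ |Real.log η| * x := by positivity
  rw [abs_le]
  constructor <;> linarith [h3.1, h3.2, h4.1, h4.2]

lemma stPsi_bounds {η ε : ℝ} (hη : 0 < η) (hε : 0 < ε) : ∃ C : ℝ, 0 ≤ C ∧ ∀ x y, η ≤ x →
    0 ≤ stPsi y x ∧ stPsi y x ≤ ε * |y| + C := by
  refine ⟨ε * η + |Real.log (ε * η)|, by positivity, fun x y hx => ?_⟩
  have hx0 : 0 < x := hη.trans_le hx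
  rw [stPsi_eq hx0]
  constructor
  · have : 0 ≤ Real.log (1 + (y / x) ^ 2) := Real.log_nonneg (by nlinarith [sq_nonneg (y/x)])
    positivity
  · have h1 : 1 + (y / x) ^ 2 ≤ (1 + |y| / η) ^ 2 := by
      have : (y / x) ^ 2 ≤ (|y| / η) ^ 2 := by
        rw [← sq_abs (y / x), abs_div, abs_of_pos hx0]
        gcongr
      have h2 : 0 ≤ |y| / η := by positivity
      nlinarith
    have h2 := Real.log_le_log (by positivity) h1
    rw [Real.log_pow] at h2
    have h3 := log_one_add_le (mul_pos hε hη) (show 0 ≤ |y| / η by positivity)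
    have h4 : ε * η * (|y| / η) = ε * |y| := by field_simp
    rw [h4] at h3
    push_cast at h2
    linarith

lemma stirling {η ε : ℝ} (hη : 0 < η) (hε : 0 < ε) : ∃ C : ℝ, 0 ≤ C ∧ ∀ x y : ℝ, η ≤ x →
    |Real.log ‖Complex.Gamma (x + y * Complex.I)‖ - stE x y| ≤ ε * |y| + C * (x + 1) := by
  obtain ⟨C1, hC1, h1⟩ := real_stirling hη
  obtain ⟨C2, hC2, h2⟩ := stPsi_bounds hη hε
  refine ⟨C1 + C2, by positivity, fun x y hx => ?_⟩
  have hx0 : 0 < x := hη.trans_le hx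
  have h3 := Gamma_norm_bounds hx0 y
  have h4 := abs_le.1 (h1 x hx)
  have h5 := h2 x y hx
  simp only [stPhi] at h3
  have h6 : 0 ≤ C2 * x := by positivity
  have h7 : 0 ≤ ε * |y| := by positivity
  rw [abs_le]
  constructor <;> linarith [h3.1, h3.2, h4.1, h4.2, h5.1, h5.2]

lemma stE_shift {η ε : ℝ} (hη : 0 < η) (hε : 0 < ε) (a₁ a₂ : ℝ) : ∃ C : ℝ, 0 ≤ C ∧
    ∀ x y : ℝ, η ≤ x → η ≤ x + a₁ →
      |stE (x + a₁) (y + a₂) - stE x y| ≤ ε * |y| + C * (x + 1) := by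
  set ε' := ε / (|a₁| + 1) with hε'
  have hε'0 : 0 < ε' := by positivity
  set L := ε' * (1 + |a₁|) + (ε' + |Real.log ε'|) + |Real.log η| + 1 with hL
  have hL0 : 0 ≤ L := by positivity
  refine ⟨(Real.pi / 2) * |a₂| + L * |a₁|, by positivity, fun x y hx hxa => ?_⟩
  have hx0 : 0 < x := hη.trans_le hx
  have hxa0 : 0 < x + a₁ := hη.trans_le hxa
  have h1 : |stE (x + a₁) (y + a₂) - stE (x + a₁) y| ≤ (Real.pi / 2) * |a₂| := by
    have := convex_univ.norm_image_sub_le_of_norm_hasDerivWithin_le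
      (f := fun t => stE (x + a₁) t) (C := Real.pi / 2) (x := y) (y := y + a₂)
      (fun t _ => (stE_deriv_y hxa0 t).hasDerivWithinAt)
      (fun t _ => by
        rw [norm_neg, Real.norm_eq_abs, abs_le]
        exact ⟨(Real.neg_pi_div_two_lt_arctan _).le, (Real.arctan_lt_pi_div_two _).le⟩)
      (Set.mem_univ _) (Set.mem_univ _)
    simpa using this
  have h2 : |stE (x + a₁) y - stE x y| ≤ (ε' * |y| + L * (x + 1)) * |a₁| := by
    have hmem : ∀ t ∈ Set.uIcc x (x + a₁), η ≤ t ∧ t ≤ x + |a₁| := by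
      intro t ht
      rw [Set.mem_uIcc] at ht
      have := le_abs_self a₁
      have := abs_nonneg a₁
      rcases ht with ht | ht <;> constructor <;> linarith [ht.1, ht.2]
    have := (convex_uIcc x (x + a₁)).norm_image_sub_le_of_norm_hasDerivWithin_le
      (f := fun t => stE t y) (C := ε' * |y| + L * (x + 1)) (x := x) (y := x + a₁)
      (fun t ht => (stE_deriv_x (hη.trans_le (hmem t ht).1) y).hasDerivWithinAt)
      (fun t ht => by
        obtain ⟨ht1, ht2⟩ := hmem t ht
        have ht0 : 0 < t := hη.trans_le ht1
        have e1 : Real.log (t ^ 2 + y ^ 2) ≤ 2 * Real.log (1 + (t + |y|)) := by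
          have : t ^ 2 + y ^ 2 ≤ (1 + (t + |y|)) ^ 2 := by
            rw [← sq_abs y]
            nlinarith [abs_nonneg y, mul_nonneg ht0.le (abs_nonneg y)]
          have := Real.log_le_log (by positivity) this
          rw [Real.log_pow] at this
          exact_mod_cast this
        have e2 := log_one_add_le hε'0 (show 0 ≤ t + |y| by positivity)
        have e3 : 2 * Real.log η ≤ Real.log (t ^ 2 + y ^ 2) := by
          have : η ^ 2 ≤ t ^ 2 + y ^ 2 := by nlinarith [sq_nonneg y]
          have := Real.log_le_log (by positivity) this
          rw [Real.log_pow] at this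
          exact_mod_cast this
        have e4 := neg_abs_le (Real.log η)
        have e5 : L ≤ L * (x + 1) := by nlinarith
        have e6 : ε' * t ≤ ε' * (x + |a₁|) := by gcongr
        have e7 : 0 ≤ ε' * |a₁| := by positivity
        have e8 : 0 ≤ ε' * |y| := by positivity
        have e9 : ε' * x ≤ L * x := by
          apply mul_le_mul_of_nonneg_right _ hx0.le
          have := abs_nonneg (Real.log η)
          have := abs_nonneg (Real.log ε')
          rw [hL]; nlinarith
        have e10 := abs_nonneg (Real.log η)
        have e11 := abs_nonneg (Real.log ε')
        rw [Real.norm_eq_abs, abs_le]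
        constructor
        · linarith
        · have : L * (x + 1) = L * x + L := by ring
          linarith)
      Set.left_mem_uIcc Set.right_mem_uIcc
    simpa using this
  have h3 : ε' * |a₁| ≤ ε := by
    rw [hε', div_mul_eq_mul_div, div_le_iff₀ (by positivity)]
    nlinarith [abs_nonneg a₁]
  have h4 : ε' * |a₁| * |y| ≤ ε * |y| := by gcongr
  have h5 : 0 ≤ Real.pi / 2 * |a₂| * x := by positivity
  have h6 := abs_sub_le (stE (x + a₁) (y + a₂)) (stE (x + a₁) y) (stE x y)
  nlinarith

lemma stE_scale {α x : ℝ} (hα : 0 < α) (hx : 0 < x) (y : ℝ) :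
    stE (α * x) (α * y) = α * stE x y + α * Real.log α * x := by
  have h : (α * x) ^ 2 + (α * y) ^ 2 = α ^ 2 * (x ^ 2 + y ^ 2) := by ring
  rw [stE, stE, h, Real.log_mul (by positivity) (by positivity), Real.log_pow,
    mul_div_mul_left _ _ hα.ne']
  push_cast
  ring

lemma Gamma_lin {α ε : ℝ} (hα : 0 < α) (hε : 0 < ε) (a : ℂ) (ha : 0 < α + a.re) :
    ∃ C : ℝ, 0 ≤ C ∧ ∀ x y : ℝ, 1 ≤ x →
      |Real.log ‖Complex.Gamma (α * (x + y * Complex.I) + a)‖ - α * stE x y| ≤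
        ε * |y| + C * x := by
  set η := min α (α + a.re) with hη
  have hη0 : 0 < η := lt_min hα ha
  set ε' := ε / (2 * α) with hε'
  have hε'0 : 0 < ε' := by positivity
  obtain ⟨C1, hC1, h1⟩ := stirling hη0 hε'0
  obtain ⟨C2, hC2, h2⟩ := stE_shift hη0 hε'0 a.re a.im
  refine ⟨(C1 * (α + |a.re| + 1) + ε' * |a.im|) + C2 * (α + 1) + |α * Real.log α|,
    by positivity, fun x y hx => ?_⟩
  have e1 : η ≤ α * x := (min_le_left _ _).trans (by nlinarith)
  have e2 : η ≤ α * x + a.re := (min_le_right _ _).trans (by nlinarith)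
  have g1 := h1 (α * x + a.re) (α * y + a.im) e2
  have g2 := h2 (α * x) (α * y) e1 e2
  rw [stE_scale hα (by linarith)] at g2
  have hz : ((α * x + a.re : ℝ) : ℂ) + ((α * y + a.im : ℝ) : ℂ) * Complex.I =
      α * (x + y * Complex.I) + a := by
    apply Complex.ext <;> simp
  rw [hz] at g1
  have e3 : ε' * |α * y| = ε / 2 * |y| := by
    rw [abs_mul, abs_of_pos hα, hε']; field_simp
  have e4 : ε' * |α * y + a.im| ≤ ε / 2 * |y| + ε' * |a.im| := by
    rw [← e3, ← mul_add]
    gcongr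
    exact abs_add_le _ _
  rw [e3] at g2
  have e5 : ε' * |a.im| ≤ ε' * |a.im| * x := le_mul_of_one_le_right (by positivity) hx
  have e6 : C1 * (α * x + a.re + 1) ≤ C1 * (α + |a.re| + 1) * x := by
    rw [mul_assoc]
    gcongr
    have := le_abs_self a.re
    nlinarith [abs_nonneg a.re]
  have e7 : C2 * (α * x + 1) ≤ C2 * (α + 1) * x := by
    rw [mul_assoc]
    gcongr
    nlinarith
  have e8 : |α * Real.log α * x| = |α * Real.log α| * x := by
    rw [abs_mul, abs_of_pos (by linarith : (0:ℝ) < x)]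
  have e9 := abs_le.1 e8.le
  have g1' := abs_le.1 g1
  have g2' := abs_le.1 g2
  rw [abs_le]
  constructor <;> nlinarith [g1'.1, g1'.2, g2'.1, g2'.2, e9.1, e9.2]

lemma Gamma_lin_upper {α ε : ℝ} (hα : 0 < α) (hε : 0 < ε) (a : ℂ) (ha : 0 < α + a.re) :
    ∃ C : ℝ, 0 ≤ C ∧ ∀ x y : ℝ, 1 ≤ x →
      ‖Complex.Gamma (α * (x + y * Complex.I) + a)‖ ≤
        Real.exp (α * stE x y + (ε * |y| + C * x)) := by
  obtain ⟨C, hC, h⟩ := Gamma_lin hα hε a ha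
  refine ⟨C, hC, fun x y hx => ?_⟩
  have hne : Complex.Gamma (α * (x + y * Complex.I) + a) ≠ 0 := by
    apply Complex.Gamma_ne_zero_of_re_pos
    simp
    nlinarith
  rw [← Real.log_le_iff_le_exp (by positivity)]
  linarith [(abs_le.1 (h x y hx)).2]

lemma Gamma_lin_inv {α ε : ℝ} (hα : 0 < α) (hε : 0 < ε) (a : ℂ) (ha : 0 < α + a.re) :
    ∃ C : ℝ, 0 ≤ C ∧ ∀ x y : ℝ, 1 ≤ x →
      ‖(Complex.Gamma (α * (x + y * Complex.I) + a))⁻¹‖ ≤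
        Real.exp (-α * stE x y + (ε * |y| + C * x)) := by
  obtain ⟨C, hC, h⟩ := Gamma_lin hα hε a ha
  refine ⟨C, hC, fun x y hx => ?_⟩
  have hne : Complex.Gamma (α * (x + y * Complex.I) + a) ≠ 0 := by
    apply Complex.Gamma_ne_zero_of_re_pos
    simp
    nlinarith
  rw [norm_inv, ← Real.log_le_iff_le_exp (by positivity), Real.log_inv]
  linarith [(abs_le.1 (h x y hx)).1]

lemma lin_bound {α ε : ℝ} (hα : 0 < α) (hε : 0 < ε) (a : ℂ) :
    ∃ C : ℝ, 0 ≤ C ∧ ∀ x y : ℝ, 1 ≤ x →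
      ‖(α : ℂ) * (x + y * Complex.I) + a‖ ≤ Real.exp (ε * |y| + C * x) := by
  set δ := ε / α with hδ
  have hδ0 : 0 < δ := by positivity
  refine ⟨δ * (α + ‖a‖) + (δ + |Real.log δ|), by positivity, fun x y hx => ?_⟩
  have h1 : ‖(α : ℂ) * (x + y * Complex.I) + a‖ ≤ 1 + (α * (x + |y|) + ‖a‖) := by
    have e1 := norm_add_le ((α : ℂ) * (x + y * Complex.I)) a
    have e2 := norm_add_le (x : ℂ) (y * Complex.I)
    rw [norm_mul] at e1
    simp only [norm_mul, Complex.norm_real, Complex.norm_I, mul_one, Real.norm_eq_abs,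
      abs_of_pos hα, abs_of_pos (by linarith : (0:ℝ) < x)] at e1 e2
    have e3 := mul_le_mul_of_nonneg_left e2 hα.le
    linarith
  have h2 := log_one_add_le hδ0 (show 0 ≤ α * (x + |y|) + ‖a‖ by positivity)
  refine h1.trans ?_
  rw [← Real.log_le_iff_le_exp (by positivity)]
  have e1 : δ * (α * (x + |y|) + ‖a‖) = ε * |y| + (δ * α * x + δ * ‖a‖) := by
    rw [hδ]; field_simp; ring
  have e2 : δ * ‖a‖ ≤ δ * ‖a‖ * x := le_mul_of_one_le_right (by positivity) hx
  have e3 : δ + |Real.log δ| ≤ (δ + |Real.log δ|) * x := le_mul_of_one_le_right (by positivity) hx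
  nlinarith

lemma Gamma_lin_inv' {β : ℝ} (hβ : 0 < β) (m : ℕ) : ∀ (b : ℂ), 0 < β + b.re + m →
    ∀ ε > 0, ∃ C : ℝ, 0 ≤ C ∧ ∀ x y : ℝ, 1 ≤ x →
      ‖(Complex.Gamma (β * (x + y * Complex.I) + b))⁻¹‖ ≤
        Real.exp (-β * stE x y + (ε * |y| + C * x)) := by
  induction m with
  | zero => exact fun b hb ε hε => Gamma_lin_inv hβ hε b (by simpa using hb)
  | succ m ih =>
    intro b hb ε hε
    obtain ⟨C1, hC1, h1⟩ := ih (b + 1) (by push_cast at hb; simp; linarith) (ε / 2) (by positivity)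
    obtain ⟨C2, hC2, h2⟩ := lin_bound hβ (show 0 < ε / 2 by positivity) b
    refine ⟨C1 + C2, by positivity, fun x y hx => ?_⟩
    have := Complex.one_div_Gamma_eq_self_mul_one_div_Gamma_add_one (β * (x + y * Complex.I) + b)
    rw [this, norm_mul]
    have e1 := h1 x y hx
    have e2 := h2 x y hx
    rw [← add_assoc] at e1
    refine (mul_le_mul e2 e1 (norm_nonneg _) (Real.exp_pos _).le).trans ?_
    rw [← Real.exp_add, Real.exp_le_exp]
    apply le_of_eq
    ring

lemma Gamma_lin_inv_all {β : ℝ} (hβ : 0 < β) (b : ℂ) {ε : ℝ} (hε : 0 < ε) :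
    ∃ C : ℝ, 0 ≤ C ∧ ∀ x y : ℝ, 1 ≤ x →
      ‖(Complex.Gamma (β * (x + y * Complex.I) + b))⁻¹‖ ≤
        Real.exp (-β * stE x y + (ε * |y| + C * x)) := by
  obtain ⟨m, hm⟩ := exists_nat_gt (-(β + b.re))
  exact Gamma_lin_inv' hβ m b (by linarith) ε hε

lemma neg_stE_le {x : ℝ} (hx : 1 ≤ x) (y : ℝ) :
    -stE x y ≤ -(x * Real.log x) + Real.pi / 2 * |y| := by
  have h1 : Real.log x ≤ Real.log (x ^ 2 + y ^ 2) / 2 := by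
    have := Real.log_le_log (by positivity) (show x ^ 2 ≤ x ^ 2 + y ^ 2 by nlinarith [sq_nonneg y])
    rw [Real.log_pow] at this
    push_cast at this
    linarith
  have h2 := mul_le_mul_of_nonneg_left h1 (by linarith : 0 ≤ x)
  have h3 : y * Real.arctan (y / x) ≤ Real.pi / 2 * |y| := by
    refine (le_abs_self _).trans ?_
    rw [abs_mul, mul_comm]
    gcongr
    rw [abs_le]
    exact ⟨(Real.neg_pi_div_two_lt_arctan _).le, (Real.arctan_lt_pi_div_two _).le⟩
  rw [stE]
  linarith

lemma integrable_exp_neg_abs' {δ : ℝ} (hδ : 0 < δ) :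
    MeasureTheory.Integrable (fun y : ℝ => Real.exp (-(δ * |y|))) := by
  rw [← MeasureTheory.integrableOn_univ, ← Set.Iic_union_Ioi (a := (0 : ℝ))]
  refine MeasureTheory.IntegrableOn.union ?_ ?_
  · refine (integrableOn_exp_mul_Iic hδ 0).congr_fun (fun y hy => ?_) measurableSet_Iic
    simp only [abs_of_nonpos (Set.mem_Iic.1 hy)]
    congr 1; ring
  · refine (integrableOn_exp_mul_Ioi (neg_lt_zero.2 hδ) 0).congr_fun (fun y hy => ?_)
      measurableSet_Ioi
    simp only [abs_of_pos (Set.mem_Ioi.1 hy)]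
    congr 1; ring

lemma integrable_line {f : ℝ → ℂ} (hf : Continuous f) {M δ : ℝ} (hδ : 0 < δ)
    (hb : ∀ y, 1 ≤ |y| → ‖f y‖ ≤ M * Real.exp (-(δ * |y|))) : MeasureTheory.Integrable f := by
  obtain ⟨B, hB⟩ := (isCompact_Icc (a := (-1 : ℝ)) (b := 1)).exists_bound_of_continuousOn
    hf.continuousOn
  have hB0 : 0 ≤ B := (norm_nonneg _).trans (hB 0 (by simp))
  refine ((integrable_exp_neg_abs' hδ).const_mul (|M| + B * Real.exp δ)).mono'
    hf.aestronglyMeasurable (Eventually.of_forall fun y => ?_)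
  rw [add_mul]
  have e1 : 0 ≤ B * Real.exp δ * Real.exp (-(δ * |y|)) := by positivity
  have e2 : 0 ≤ |M| * Real.exp (-(δ * |y|)) := by positivity
  rcases le_total 1 |y| with h | h
  · have := hb y h
    have e3 : M * Real.exp (-(δ * |y|)) ≤ |M| * Real.exp (-(δ * |y|)) := by
      gcongr; exact le_abs_self M
    linarith
  · have := hB y (abs_le.1 h)
    have e3 : B ≤ B * Real.exp δ * Real.exp (-(δ * |y|)) := by
      rw [mul_assoc, ← Real.exp_add]
      apply le_mul_of_one_le_right hB0
      rw [Real.one_le_exp_iff]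
      nlinarith
    linarith

lemma contour_shift {F : ℂ → ℂ} {l r : ℝ} (hlr : l ≤ r)
    (hd : ∀ u : ℂ, l ≤ u.re → u.re ≤ r → DifferentiableAt ℂ F u) {M δ : ℝ} (hδ : 0 < δ)
    (hb : ∀ x y : ℝ, l ≤ x → x ≤ r → 1 ≤ |y| →
      ‖F (x + y * Complex.I)‖ ≤ M * Real.exp (-(δ * |y|))) :
    MeasureTheory.Integrable (fun y : ℝ => F (l + y * Complex.I)) ∧
    MeasureTheory.Integrable (fun y : ℝ => F (r + y * Complex.I)) ∧
    ∫ y : ℝ, F (l + y * Complex.I) = ∫ y : ℝ, F (r + y * Complex.I) := by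
  have hc : ∀ x : ℝ, l ≤ x → x ≤ r → Continuous (fun y : ℝ => F (x + y * Complex.I)) := by
    intro x h1 h2
    rw [continuous_iff_continuousAt]
    intro y
    have := (hd (x + y * Complex.I) (by simpa using h1) (by simpa using h2)).continuousAt
    exact ContinuousAt.comp (f := fun y : ℝ => (x + y * Complex.I : ℂ)) this (by fun_prop)
  have il := integrable_line (hc l le_rfl hlr) hδ (fun y hy => hb l y le_rfl hlr hy)
  have ir := integrable_line (hc r hlr le_rfl) hδ (fun y hy => hb r y hlr le_rfl hy)
  refine ⟨il, ir, ?_⟩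
  have tneg : Tendsto (fun T : ℝ => -T) atTop atBot := tendsto_neg_atTop_atBot
  have tl := MeasureTheory.intervalIntegral_tendsto_integral il tneg tendsto_id
  have tr := MeasureTheory.intervalIntegral_tendsto_integral ir tneg tendsto_id
  have hexp : Tendsto (fun T : ℝ => M * Real.exp (-(δ * T)) * |r - l|) atTop (𝓝 0) := by
    have : Tendsto (fun T : ℝ => Real.exp (-(δ * T))) atTop (𝓝 0) :=
      Real.tendsto_exp_neg_atTop_nhds_zero.comp (tendsto_id.const_mul_atTop hδ)
    simpa using (this.const_mul M).mul_const |r - l|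
  have hbd : ∀ T : ℝ, 1 ≤ |T| →
      ‖∫ x : ℝ in l..r, F (x + T * Complex.I)‖ ≤ M * Real.exp (-(δ * |T|)) * |r - l| := by
    intro T hT
    apply intervalIntegral.norm_integral_le_of_norm_le_const
    intro x hx
    rw [Set.uIoc_of_le hlr] at hx
    exact hb x T hx.1.le hx.2 hT
  have hp : Tendsto (fun T : ℝ => ∫ x : ℝ in l..r, F (x + T * Complex.I)) atTop (𝓝 0) := by
    refine squeeze_zero_norm' ?_ hexp
    filter_upwards [eventually_ge_atTop 1] with T hT
    have := hbd T (hT.trans (le_abs_self T))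
    rwa [abs_of_nonneg (by linarith : 0 ≤ T)] at this
  have hm : Tendsto (fun T : ℝ => ∫ x : ℝ in l..r, F (x + (-T : ℝ) * Complex.I)) atTop (𝓝 0) := by
    refine squeeze_zero_norm' ?_ hexp
    filter_upwards [eventually_ge_atTop 1] with T hT
    have := hbd (-T) (by rw [abs_neg]; exact hT.trans (le_abs_self T))
    rwa [abs_neg, abs_of_nonneg (by linarith : 0 ≤ T)] at this
  have hz : ∀ T : ℝ, (∫ x : ℝ in l..r, F (x + (-T : ℝ) * Complex.I)) -
      (∫ x : ℝ in l..r, F (x + T * Complex.I)) +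
      Complex.I • (∫ y : ℝ in (-T)..T, F (r + y * Complex.I)) -
      Complex.I • (∫ y : ℝ in (-T)..T, F (l + y * Complex.I)) = 0 := by
    intro T
    have := Complex.integral_boundary_rect_eq_zero_of_differentiableOn F ⟨l, -T⟩ ⟨r, T⟩
      (fun u hu => (hd u ?_ ?_).differentiableWithinAt)
    · exact this
    · have := hu.1
      simp only [Set.mem_preimage, Set.uIcc_of_le hlr] at this
      exact this.1
    · have := hu.1
      simp only [Set.mem_preimage, Set.uIcc_of_le hlr] at this
      exact this.2
  have hlim := ((hm.sub hp).add (tr.const_smul Complex.I)).sub (tl.const_smul Complex.I)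
  simp only [id] at hlim
  simp only [hz] at hlim
  have := tendsto_nhds_unique hlim tendsto_const_nhds
  simp only [sub_zero, zero_add, smul_eq_mul, ← mul_sub] at this
  rcases mul_eq_zero.1 this with h | h
  · exact absurd h Complex.I_ne_zero
  · exact (sub_eq_zero.1 h).symm

noncomputable def cscP (u : ℂ) : ℂ := Real.pi / Complex.sin (Real.pi * u)

lemma sin_pi_ne {u : ℂ} (h : ∀ k : ℤ, u ≠ k) : Complex.sin (Real.pi * u) ≠ 0 := by
  rw [Ne, Complex.sin_eq_zero_iff]
  rintro ⟨k, hk⟩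
  apply h k
  have : (Real.pi : ℂ) ≠ 0 := by exact_mod_cast Real.pi_ne_zero
  apply mul_left_cancel₀ this
  rw [hk]; ring

lemma cscP_diff {u : ℂ} (h : ∀ k : ℤ, u ≠ k) : DifferentiableAt ℂ cscP u := by
  unfold cscP
  refine DifferentiableAt.div (by fun_prop) (by fun_prop) (sin_pi_ne h)

lemma cscP_bound (x y : ℝ) (hy : 1 ≤ |y|) :
    ‖cscP (x + y * Complex.I)‖ ≤ 4 * Real.pi * Real.exp (-(Real.pi * |y|)) := by
  have h1 : Real.exp (Real.pi * |y|) / 4 ≤ ‖Complex.sin (Real.pi * (x + y * Complex.I))‖ := by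
    rw [Complex.sin, norm_div, norm_mul, Complex.norm_I, mul_one]
    have e := abs_norm_sub_norm_le (Complex.exp (-(Real.pi * (x + y * Complex.I)) * Complex.I))
      (Complex.exp ((Real.pi * (x + y * Complex.I)) * Complex.I))
    rw [Complex.norm_exp, Complex.norm_exp] at e
    have r1 : (-(Real.pi * (x + y * Complex.I)) * Complex.I).re = Real.pi * y := by simp
    have r2 : ((Real.pi * (x + y * Complex.I)) * Complex.I).re = -(Real.pi * y) := by simp
    rw [r1, r2] at e
    have e2 : Real.exp (Real.pi * |y|) / 2 ≤
        |Real.exp (Real.pi * y) - Real.exp (-(Real.pi * y))| := by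
      have h3 : 2 ≤ Real.exp (Real.pi * |y|) := by
        have := Real.add_one_le_exp (Real.pi * |y|)
        nlinarith [Real.two_le_pi]
      have h4 : Real.exp (-(Real.pi * |y|)) ≤ 1 := by
        rw [Real.exp_le_one_iff]; nlinarith [Real.pi_pos]
      rcases abs_cases y with ⟨h, _⟩ | ⟨h, _⟩
      · rw [h] at h3 h4 ⊢
        refine le_trans ?_ (le_abs_self _)
        linarith
      · rw [h] at h3 h4 ⊢
        refine le_trans ?_ (neg_le_abs _)
        simp only [mul_neg, neg_neg] at h3 h4 ⊢
        linarith
    have : ‖(2 : ℂ)‖ = 2 := by simp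
    rw [this]
    linarith
  rw [cscP, norm_div, Complex.norm_real, Real.norm_eq_abs, abs_of_pos Real.pi_pos,
    div_le_iff₀ (lt_of_lt_of_le (by positivity) h1)]
  calc Real.pi = 4 * Real.pi * Real.exp (-(Real.pi * |y|)) * (Real.exp (Real.pi * |y|) / 4) := by
        rw [show 4 * Real.pi * Real.exp (-(Real.pi * |y|)) * (Real.exp (Real.pi * |y|) / 4) =
          Real.pi * (Real.exp (-(Real.pi * |y|)) * Real.exp (Real.pi * |y|)) by ring,
          ← Real.exp_add]
        simp
    _ ≤ _ := by gcongr

lemma cscP_half (n : ℕ) (y : ℝ) :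
    cscP (((n : ℝ) + 1 / 2 : ℝ) + y * Complex.I) =
      (-1) ^ n * ((Real.pi / Real.cosh (Real.pi * y) : ℝ) : ℂ) := by
  have : (Real.pi : ℂ) * ((((n : ℝ) + 1 / 2 : ℝ) : ℂ) + y * Complex.I) =
    (Real.pi * y : ℝ) * Complex.I + Real.pi / 2 + n * Real.pi := by push_cast; ring
  rw [cscP, this, Complex.sin_antiperiodic.add_nat_mul_eq, Complex.sin_add_pi_div_two, Complex.cos_mul_I,
    ← Complex.ofReal_cosh]
  push_cast
  rcases neg_one_pow_eq_or ℂ n with h | h <;> rw [h] <;> simp [neg_div, div_neg]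

lemma cscP_neg_half (y : ℝ) :
    cscP ((-(1 / 2) : ℝ) + y * Complex.I) =
      -((Real.pi / Real.cosh (Real.pi * y) : ℝ) : ℂ) := by
  have : (Real.pi : ℂ) * (((-(1 / 2) : ℝ) : ℂ) + y * Complex.I) =
    (Real.pi * y : ℝ) * Complex.I - Real.pi / 2 := by push_cast; ring
  rw [cscP, this, Complex.sin_sub_pi_div_two, Complex.cos_mul_I, ← Complex.ofReal_cosh]
  push_cast
  rw [div_neg]

lemma sech_bound (y : ℝ) :
    Real.pi / Real.cosh (Real.pi * y) ≤ 2 * Real.pi * Real.exp (-(Real.pi * |y|)) := by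
  rw [div_le_iff₀ (Real.cosh_pos _)]
  have : Real.exp (Real.pi * |y|) / 2 ≤ Real.cosh (Real.pi * y) := by
    rw [← Real.cosh_abs, abs_mul, abs_of_pos Real.pi_pos, Real.cosh_eq]
    have := Real.exp_pos (-(Real.pi * |y|))
    linarith
  calc Real.pi = 2 * Real.pi * Real.exp (-(Real.pi * |y|)) * (Real.exp (Real.pi * |y|) / 2) := by
        rw [show 2 * Real.pi * Real.exp (-(Real.pi * |y|)) * (Real.exp (Real.pi * |y|) / 2) =
          Real.pi * (Real.exp (-(Real.pi * |y|)) * Real.exp (Real.pi * |y|)) by ring,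
          ← Real.exp_add]
        simp
    _ ≤ _ := by gcongr

lemma sech_integral : ∫ y : ℝ, Real.pi / Real.cosh (Real.pi * y) = Real.pi := by
  have hint : MeasureTheory.Integrable (fun y : ℝ => Real.pi / Real.cosh (Real.pi * y)) := by
    refine ((integrable_exp_neg_abs' Real.pi_pos).const_mul (2 * Real.pi)).mono' ?_
      (Eventually.of_forall fun y => ?_)
    · apply Continuous.aestronglyMeasurable
      refine continuous_const.div (by fun_prop) (fun y => (Real.cosh_pos _).ne')
    · rw [Real.norm_eq_abs, abs_of_pos (div_pos Real.pi_pos (Real.cosh_pos _))]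
      exact sech_bound y
  have hd : ∀ y : ℝ, HasDerivAt (fun y => 2 * Real.arctan (Real.exp (Real.pi * y)))
      (Real.pi / Real.cosh (Real.pi * y)) y := by
    intro y
    have h1 : HasDerivAt (fun y => Real.pi * y) Real.pi y := by
      simpa using (hasDerivAt_id y).const_mul Real.pi
    refine ((h1.exp.arctan).const_mul 2).congr_deriv ?_
    rw [Real.cosh_eq, Real.exp_neg]
    have := Real.exp_pos (Real.pi * y)
    field_simp
    ring
  have ht : Tendsto (fun y => 2 * Real.arctan (Real.exp (Real.pi * y))) atTop (𝓝 Real.pi) := by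
    have h1 : Tendsto (fun y : ℝ => Real.exp (Real.pi * y)) atTop atTop :=
      Real.tendsto_exp_atTop.comp (tendsto_id.const_mul_atTop Real.pi_pos)
    have h2 := (tendsto_nhds_of_tendsto_nhdsWithin Real.tendsto_arctan_atTop).comp h1
    have h3 := h2.const_mul 2
    rw [show 2 * (Real.pi / 2) = Real.pi by ring] at h3
    exact h3
  have hb : Tendsto (fun y => 2 * Real.arctan (Real.exp (Real.pi * y))) atBot (𝓝 0) := by
    have h1 : Tendsto (fun y : ℝ => Real.exp (Real.pi * y)) atBot (𝓝 0) :=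
      Real.tendsto_exp_atBot.comp (tendsto_id.const_mul_atBot Real.pi_pos)
    have h2 := (Real.continuous_arctan.tendsto 0).comp h1
    have h3 := h2.const_mul 2
    simpa using h3
  have := MeasureTheory.integral_of_hasDerivAt_of_tendsto hd hint hb ht
  rw [this, sub_zero]

lemma K_half (n : ℕ) : ∫ y : ℝ, cscP (((n : ℝ) + 1 / 2 : ℝ) + y * Complex.I) =
    (-1) ^ n * Real.pi := by
  simp only [cscP_half]
  rw [MeasureTheory.integral_const_mul, integral_complex_ofReal, sech_integral]

lemma K_neg_half : ∫ y : ℝ, cscP ((-(1 / 2) : ℝ) + y * Complex.I) = -Real.pi := by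
  simp only [cscP_neg_half]
  rw [MeasureTheory.integral_neg, integral_complex_ofReal, sech_integral]

lemma ne_int_of_re {u : ℂ} {m : ℤ} (h1 : (m : ℝ) < u.re) (h2 : u.re < m + 1) (k : ℤ) :
    u ≠ k := by
  rintro rfl
  simp only [Complex.intCast_re] at h1 h2
  have h3 : m < k := by exact_mod_cast h1
  have h4 : k < m + 1 := by exact_mod_cast h2
  omega

lemma K_neg {c : ℝ} (h0 : 0 < c) (h1 : c < 1) :
    ∫ y : ℝ, cscP ((-c : ℝ) + y * Complex.I) = -Real.pi := by
  have key : ∀ l r : ℝ, -1 < l → l ≤ r → r < 0 →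
      ∫ y : ℝ, cscP (l + y * Complex.I) = ∫ y : ℝ, cscP (r + y * Complex.I) := by
    intro l r h1 h2 h3
    exact (contour_shift h2 (fun u hu1 hu2 => cscP_diff
      (ne_int_of_re (m := -1) (by push_cast; linarith) (by push_cast; linarith))) Real.pi_pos
      (fun x y _ _ hy => cscP_bound x y hy)).2.2
  rw [← K_neg_half]
  rcases le_total (-c) (-(1/2)) with h | h
  · exact key _ _ (by linarith) h (by linarith)
  · exact (key _ _ (by linarith) h (by linarith)).symm

lemma strip_bound {H : ℂ → ℂ} {c κ C θ : ℝ} (hκ : 0 < κ) (hC : 0 ≤ C)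
    (hb : ∀ x y : ℝ, -c ≤ x → ‖H (x + y * Complex.I)‖ ≤
      Real.exp (-(κ * ((x + c + 1) * Real.log (x + c + 1))) + C * (x + c + 1) + θ * |y|))
    {x r : ℝ} (y : ℝ) (hx : -c ≤ x) (hr : x ≤ r) :
    ‖H (x + y * Complex.I)‖ ≤ Real.exp (C * (r + c + 1)) * Real.exp (θ * |y|) := by
  refine (hb x y hx).trans ?_
  rw [← Real.exp_add, Real.exp_le_exp]
  have h1 : 0 ≤ Real.log (x + c + 1) := Real.log_nonneg (by linarith)
  have h2 : 0 ≤ κ * ((x + c + 1) * Real.log (x + c + 1)) :=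
    mul_nonneg hκ.le (mul_nonneg (by linarith) h1)
  have h3 : C * (x + c + 1) ≤ C * (r + c + 1) := by gcongr
  linarith

lemma strip_step {H : ℂ → ℂ} {c κ C θ : ℝ} (hκ : 0 < κ) (hC : 0 ≤ C)
    (hθ0 : 0 ≤ θ) (hθ : θ < Real.pi)
    (hd : DifferentiableOn ℂ H {u | -c < u.re})
    (hb : ∀ x y : ℝ, -c ≤ x → ‖H (x + y * Complex.I)‖ ≤
      Real.exp (-(κ * ((x + c + 1) * Real.log (x + c + 1))) + C * (x + c + 1) + θ * |y|))
    {l r : ℝ} (n : ℕ) (hl : -c < l) (hl1 : (n : ℝ) - 1 < l) (hln : l < n) (hnr : (n : ℝ) < r)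
    (hr : r < n + 1) :
    ∫ y : ℝ, cscP (r + y * Complex.I) * H (r + y * Complex.I) =
      (∫ y : ℝ, cscP (l + y * Complex.I) * H (l + y * Complex.I)) +
      H n * ((∫ y : ℝ, cscP (r + y * Complex.I)) - ∫ y : ℝ, cscP (l + y * Complex.I)) := by
  have hU : IsOpen {u : ℂ | -c < u.re} := isOpen_lt continuous_const Complex.continuous_re
  have hnU : {u : ℂ | -c < u.re} ∈ 𝓝 (n : ℂ) := hU.mem_nhds (by simp; linarith)
  set S : ℂ → ℂ := fun u => Complex.sin (Real.pi * u) with hS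
  have hSd : Differentiable ℂ S := by rw [hS]; fun_prop
  have hSn : S n = 0 := by
    simp only [hS]
    rw [mul_comm]; exact Complex.sin_nat_mul_pi n
  have hpi : (Real.pi : ℂ) ≠ 0 := by exact_mod_cast Real.pi_ne_zero
  have hSne : ∀ u : ℂ, u ≠ n → l ≤ u.re → u.re ≤ r → S u ≠ 0 := by
    intro u hu h1 h2
    apply sin_pi_ne
    rintro k rfl
    simp only [Complex.intCast_re] at h1 h2
    have h3 : ((n : ℤ) - 1 : ℤ) < k := by
      have : (((n : ℤ) - 1 : ℤ) : ℝ) < k := by push_cast; linarith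
      exact_mod_cast this
    have h4 : k < ((n : ℤ) + 1 : ℤ) := by
      have : (k : ℝ) < (((n : ℤ) + 1 : ℤ) : ℝ) := by push_cast; linarith
      exact_mod_cast this
    apply hu
    have : k = n := by omega
    rw [this]; simp
  have hdS : Differentiable ℂ (dslope S n) := by
    rw [← differentiableOn_univ, Complex.differentiableOn_dslope univ_mem]
    exact hSd.differentiableOn
  have hdH : DifferentiableOn ℂ (dslope H n) {u | -c < u.re} :=
    (Complex.differentiableOn_dslope hnU).2 hd
  have hdSne : ∀ u : ℂ, l ≤ u.re → u.re ≤ r → dslope S n u ≠ 0 := by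
    intro u h1 h2
    by_cases hu : u = n
    · rw [hu, dslope_same]
      have h1 : HasDerivAt S (Complex.cos (Real.pi * n) * Real.pi) (n : ℂ) := by
        have := ((hasDerivAt_id (n : ℂ)).const_mul (Real.pi : ℂ)).csin
        simpa using this
      rw [h1.deriv]
      refine mul_ne_zero ?_ hpi
      intro h
      have e := Complex.sin_sq_add_cos_sq (Real.pi * n)
      have e' : Complex.sin (Real.pi * n) = 0 := hSn
      rw [h, e'] at e
      norm_num at e
    · rw [dslope_of_ne _ hu, slope_def_field, hSn, sub_zero]
      exact div_ne_zero (hSne u hu h1 h2) (sub_ne_zero.2 hu)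
  set G : ℂ → ℂ := fun u => Real.pi * dslope H n u / dslope S n u with hG
  have hGd : ∀ u : ℂ, l ≤ u.re → u.re ≤ r → DifferentiableAt ℂ G u := by
    intro u h1 h2
    have h3 : DifferentiableAt ℂ (dslope H n) u :=
      (hdH u (lt_of_lt_of_le hl h1)).differentiableAt (hU.mem_nhds (lt_of_lt_of_le hl h1))
    exact (h3.const_mul _).div hdS.differentiableAt (hdSne u h1 h2)
  have hGeq : ∀ u : ℂ, u ≠ n → l ≤ u.re → u.re ≤ r → G u = cscP u * (H u - H n) := by
    intro u hu h1 h2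
    simp only [hG]
    rw [dslope_of_ne _ hu, dslope_of_ne _ hu, slope_def_field, slope_def_field, hSn, sub_zero, cscP]
    have := hSne u hu h1 h2
    simp only [hS] at this ⊢
    have h5 := sub_ne_zero.2 hu
    field_simp
  set M := Real.exp (C * (r + c + 1)) with hM
  have hGb : ∀ x y : ℝ, l ≤ x → x ≤ r → 1 ≤ |y| →
      ‖G (x + y * Complex.I)‖ ≤ (4 * Real.pi * (M + ‖H n‖)) *
        Real.exp (-((Real.pi - θ) * |y|)) := by
    intro x y h1 h2 hy
    rw [hGeq _ ?_ (by simpa using h1) (by simpa using h2), norm_mul]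
    · have e1 := cscP_bound x y hy
      have e2 := strip_bound hκ hC hb y (by linarith) h2
      have e3 : ‖H (x + y * Complex.I) - H n‖ ≤ (M + ‖H n‖) * Real.exp (θ * |y|) := by
        refine (norm_sub_le _ _).trans ?_
        rw [add_mul]
        gcongr
        apply le_mul_of_one_le_right (norm_nonneg _)
        rw [Real.one_le_exp_iff]
        positivity
      refine (mul_le_mul e1 e3 (norm_nonneg _) (by positivity)).trans (le_of_eq ?_)
      rw [show -((Real.pi - θ) * |y|) = -(Real.pi * |y|) + θ * |y| by ring, Real.exp_add]
      ring
    · intro h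
      have := congrArg Complex.im h
      simp at this
      rw [this] at hy
      norm_num at hy
  obtain ⟨g1, g2, g3⟩ := contour_shift (by linarith : l ≤ r) hGd (by linarith : 0 < Real.pi - θ) hGb
  have hline : ∀ x : ℝ, l ≤ x → x ≤ r → x ≠ n →
      MeasureTheory.Integrable (fun y : ℝ => G (x + y * Complex.I)) →
      ∫ y : ℝ, cscP (x + y * Complex.I) * H (x + y * Complex.I) =
        (∫ y : ℝ, G (x + y * Complex.I)) + H n * ∫ y : ℝ, cscP (x + y * Complex.I) := by
    intro x h1 h2 h3 h4
    have hne : ∀ y : ℝ, (x + y * Complex.I : ℂ) ≠ n := fun y h => h3 (by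
      have := congrArg Complex.re h
      simpa using this)
    have hint : MeasureTheory.Integrable (fun y : ℝ => cscP (x + y * Complex.I)) := by
      refine integrable_line ?_ Real.pi_pos (cscP_bound x)
      unfold cscP
      refine continuous_const.div (by fun_prop) (fun y => ?_)
      exact hSne _ (hne y) (by simpa using h1) (by simpa using h2)
    rw [← MeasureTheory.integral_const_mul, ← MeasureTheory.integral_add h4 (hint.const_mul _)]
    congr 1
    ext y
    rw [hGeq _ (hne y) (by simpa using h1) (by simpa using h2)]
    ring
  rw [hline r (by linarith) le_rfl hnr.ne' g2, hline l le_rfl (by linarith) hln.ne g1, g3]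
  ring

lemma super_exp {κ C : ℝ} (hκ : 0 < κ) : ∀ᶠ X : ℝ in atTop,
    -(κ * (X * Real.log X)) + C * X ≤ -X := by
  filter_upwards [(Real.tendsto_log_atTop.const_mul_atTop hκ).eventually_ge_atTop (C + 1),
    eventually_ge_atTop 0] with X h1 h2
  nlinarith

lemma contour_main {H : ℂ → ℂ} {c κ C θ : ℝ} (hκ : 0 < κ) (hC : 0 ≤ C)
    (hθ0 : 0 ≤ θ) (hθ : θ < Real.pi)
    (hd : DifferentiableOn ℂ H {u | -c < u.re})
    (hb : ∀ x y : ℝ, -c ≤ x → ‖H (x + y * Complex.I)‖ ≤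
      Real.exp (-(κ * ((x + c + 1) * Real.log (x + c + 1))) + C * (x + c + 1) + θ * |y|))
    {c₀ : ℝ} (h0 : 0 < c₀) (h1 : c₀ < 1) (hcc : c₀ < c) :
    ∫ y : ℝ, cscP ((-c₀ : ℝ) + y * Complex.I) * H ((-c₀ : ℝ) + y * Complex.I) =
      -(2 * Real.pi) * ∑' n : ℕ, H n * (-1) ^ n := by
  set J : ℝ → ℂ := fun x => ∫ y : ℝ, cscP (x + y * Complex.I) * H (x + y * Complex.I) with hJ
  have hstep : ∀ N : ℕ, J (N + 1 / 2) = J (-c₀) +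
      (2 * Real.pi) * ∑ n ∈ Finset.range (N + 1), H n * (-1) ^ n := by
    intro N
    induction N with
    | zero =>
      have := strip_step hκ hC hθ0 hθ hd hb (l := -c₀) (r := ((0 : ℕ) : ℝ) + 1 / 2) 0 (by linarith)
        (by simp; linarith) (by simp; linarith) (by simp) (by push_cast; linarith)
      rw [K_half, K_neg h0 h1] at this
      simp only [hJ]
      rw [this]
      simp
      ring
    | succ N ih =>
      have hN : (0 : ℝ) ≤ N := by positivity
      have := strip_step hκ hC hθ0 hθ hd hb (l := (N : ℝ) + 1 / 2)
        (r := ((N + 1 : ℕ) : ℝ) + 1 / 2) (N + 1) (by linarith)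
        (by push_cast; linarith) (by push_cast; linarith) (by push_cast; linarith)
        (by push_cast; linarith)
      rw [K_half, K_half] at this
      rw [Finset.sum_range_succ, mul_add, ← add_assoc, ← ih]
      simp only [hJ]
      rw [this, pow_succ]
      push_cast
      ring
  have hXt : Tendsto (fun n : ℕ => (n : ℝ) + c + 1) atTop atTop :=
    tendsto_atTop_add_const_right _ _ (tendsto_atTop_add_const_right _ _ tendsto_natCast_atTop_atTop)
  have hXt' : Tendsto (fun n : ℕ => ((n : ℝ) + 1 / 2) + c + 1) atTop atTop :=
    tendsto_atTop_add_const_right _ _ (tendsto_atTop_add_const_right _ _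
      (tendsto_atTop_add_const_right _ _ tendsto_natCast_atTop_atTop))
  have hsum : Summable (fun n : ℕ => H n * (-1) ^ n) := by
    have hg : Summable (fun n : ℕ => Real.exp (-(n : ℝ))) := Real.summable_exp_neg_nat
    refine summable_of_isBigO_nat hg (Asymptotics.IsBigO.of_bound 1 ?_)
    filter_upwards [hXt.eventually (super_exp (C := C) hκ)] with n hn
    have hn0 : (0 : ℝ) ≤ n := by positivity
    have := hb n 0 (by linarith)
    simp only [Complex.ofReal_zero, zero_mul, add_zero, abs_zero, mul_zero,
      Complex.ofReal_natCast] at this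
    rw [norm_mul, norm_pow, norm_neg, norm_one, one_pow, mul_one, one_mul, Real.norm_eq_abs,
      abs_of_pos (Real.exp_pos _)]
    refine this.trans (Real.exp_le_exp.2 (hn.trans (by linarith)))
  have hJ0 : Tendsto (fun N : ℕ => J (N + 1 / 2)) atTop (𝓝 0) := by
    set A := ∫ y : ℝ, 2 * Real.pi * Real.exp (-((Real.pi - θ) * |y|)) with hA
    have hbig : ∀ᶠ N : ℕ in atTop,
        ‖J (N + 1 / 2)‖ ≤ Real.exp (-((N : ℝ) + 1 / 2 + c + 1)) * A := by
      filter_upwards [hXt'.eventually (super_exp (C := C) hκ)] with N hN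
      have hn0 : (0 : ℝ) ≤ N := by positivity
      simp only [hJ]
      rw [hA, ← MeasureTheory.integral_const_mul]
      refine MeasureTheory.norm_integral_le_of_norm_le
        (((integrable_exp_neg_abs' (by linarith : 0 < Real.pi - θ)).const_mul _).const_mul _)
        (Eventually.of_forall fun y => ?_)
      rw [norm_mul, cscP_half, norm_mul, norm_pow, norm_neg, norm_one, one_pow, one_mul,
        Complex.norm_real, Real.norm_eq_abs, abs_of_pos (div_pos Real.pi_pos (Real.cosh_pos _))]
      have e1 := sech_bound y
      have e2 := hb ((N : ℝ) + 1 / 2) y (by linarith)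
      have e3 : Real.exp (-(κ * (((N : ℝ) + 1 / 2 + c + 1) * Real.log ((N : ℝ) + 1 / 2 + c + 1))) +
          C * ((N : ℝ) + 1 / 2 + c + 1) + θ * |y|) ≤
          Real.exp (-((N : ℝ) + 1 / 2 + c + 1) + θ * |y|) := by
        rw [Real.exp_le_exp]; linarith
      refine (mul_le_mul e1 (e2.trans e3) (norm_nonneg _) (by positivity)).trans (le_of_eq ?_)
      rw [show -((Real.pi - θ) * |y|) = -(Real.pi * |y|) + θ * |y| by ring, Real.exp_add,
        Real.exp_add]
      ring
    refine squeeze_zero_norm' hbig ?_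
    have := (Real.tendsto_exp_neg_atTop_nhds_zero.comp hXt').mul_const A
    simpa using this
  have hS := (hsum.hasSum.tendsto_sum_nat.comp (tendsto_add_atTop_nat 1)).const_mul
    (2 * (Real.pi : ℂ))
  have hT := hS.const_add (J (-c₀))
  have := tendsto_nhds_unique hJ0 (hT.congr fun N => (hstep N).symm)
  have h2 : J (-c₀) = -(2 * Real.pi) * ∑' n : ℕ, H n * (-1) ^ n := by
    linear_combination -this
  exact h2

lemma prod_upper {p : ℕ} (f : Fin p → ℝ → ℝ → ℂ) (γ : Fin p → ℝ)
    (hf : ∀ r, ∀ ε > 0, ∃ C : ℝ, 0 ≤ C ∧ ∀ x y : ℝ, 1 ≤ x →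
      ‖f r x y‖ ≤ Real.exp (γ r * stE x y + (ε * |y| + C * x))) {ε : ℝ} (hε : 0 < ε) :
    ∃ C : ℝ, 0 ≤ C ∧ ∀ x y : ℝ, 1 ≤ x →
      ‖∏ r, f r x y‖ ≤ Real.exp ((∑ r, γ r) * stE x y + (ε * |y| + C * x)) := by
  choose C hC h using fun r => hf r (ε / (p + 1)) (by positivity)
  refine ⟨∑ r, C r, Finset.sum_nonneg fun r _ => hC r, fun x y hx => ?_⟩
  rw [norm_prod]
  refine (Finset.prod_le_prod (fun r _ => norm_nonneg _) (fun r _ => h r x y hx)).trans ?_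
  rw [← Real.exp_sum, Real.exp_le_exp, Finset.sum_add_distrib, Finset.sum_add_distrib,
    ← Finset.sum_mul, ← Finset.sum_mul, ← Finset.sum_mul]
  simp only [Finset.sum_const, Finset.card_univ, Fintype.card_fin, nsmul_eq_mul]
  have : (p : ℝ) * (ε / (p + 1)) * |y| ≤ ε * |y| := by
    gcongr
    rw [mul_div_assoc', div_le_iff₀ (by positivity)]
    nlinarith
  linarith

noncomputable def wrightH (p q : ℕ) (α : Fin p → ℝ) (a : Fin p → ℂ)
    (β : Fin q → ℝ) (b : Fin q → ℂ) (w u : ℂ) : ℂ :=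
  wrightCoeff p q α a β b u * (Complex.Gamma (u + 1))⁻¹ * w ^ u

lemma wrightH_bound (p q : ℕ) (α : Fin p → ℝ) (a : Fin p → ℂ)
    (β : Fin q → ℝ) (b : Fin q → ℂ)
    (hα : ∀ r, 0 < α r) (hβ : ∀ r, 0 < β r)
    (hκ0 : 0 < 1 + ∑ r, β r - ∑ r, α r)
    (c : ℝ) (hc1 : ∀ r, c < (a r).re / α r)
    (w : ℂ) (hw : w ≠ 0)
    {ε : ℝ} (hε : 0 < ε) : ∃ C : ℝ, 0 ≤ C ∧ ∀ x y : ℝ, -c ≤ x →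
      ‖wrightH p q α a β b w (x + y * Complex.I)‖ ≤
      Real.exp (-((1 + ∑ r, β r - ∑ r, α r) * ((x + c + 1) * Real.log (x + c + 1)))
        + C * (x + c + 1) +
        (Real.pi * ((1 + ∑ r, β r - ∑ r, α r) / 2) + |w.arg| + ε) * |y|) := by
  set κ := 1 + ∑ r, β r - ∑ r, α r with hκ
  have hε3 : 0 < ε / 3 := by positivity
  obtain ⟨C1, hC1, h1⟩ := prod_upper
    (fun r x y => Complex.Gamma (α r * (x + y * Complex.I) + (a r - α r * (c + 1)))) α
    (fun r ε hε => Gamma_lin_upper (hα r) hε _ (by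
      have := hc1 r
      rw [lt_div_iff₀ (hα r)] at this
      simp
      nlinarith)) hε3
  obtain ⟨C2, hC2, h2⟩ := prod_upper
    (fun r x y => (Complex.Gamma (β r * (x + y * Complex.I) + (b r - β r * (c + 1))))⁻¹)
    (fun r => -β r) (fun r ε hε => Gamma_lin_inv_all (hβ r) _ hε) hε3
  obtain ⟨C3, hC3, h3⟩ := Gamma_lin_inv_all one_pos (-(c : ℂ)) hε3
  refine ⟨C1 + C2 + C3 + |Real.log ‖w‖| * (1 + |c + 1|), by positivity, fun x y hx => ?_⟩
  set X := x + c + 1 with hX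
  have hX1 : 1 ≤ X := by linarith
  have g1 := h1 X y hX1
  have g2 := h2 X y hX1
  have g3 := h3 X y hX1
  have hw' : ‖w ^ (x + y * Complex.I : ℂ)‖ ≤
      Real.exp (|Real.log ‖w‖| * (1 + |c + 1|) * X + |w.arg| * |y|) := by
    rw [Complex.norm_cpow_of_ne_zero hw, Real.rpow_def_of_pos (norm_pos_iff.2 hw), ← Real.exp_sub,
      Real.exp_le_exp]
    simp only [Complex.add_re, Complex.ofReal_re, Complex.mul_re, Complex.I_re, mul_zero,
      Complex.ofReal_im, Complex.I_im, mul_one, sub_self, add_zero, Complex.add_im, Complex.mul_im,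
      zero_add]
    have e1 : Real.log ‖w‖ * x ≤ |Real.log ‖w‖| * (1 + |c + 1|) * X := by
      refine (le_abs_self _).trans ?_
      rw [abs_mul, mul_assoc]
      gcongr
      have : x = X - (c + 1) := by rw [hX]; ring
      rw [this]
      refine (abs_sub _ _).trans ?_
      rw [abs_of_pos (by linarith : 0 < X)]
      nlinarith [abs_nonneg (c + 1)]
    have e2 : -(w.arg * y) ≤ |w.arg| * |y| := by
      rw [← abs_mul]; exact neg_le_abs _
    linarith
  have hu1 : ∀ (s : ℝ) (d : ℂ), (s : ℂ) * ((X : ℝ) + y * Complex.I) + (d - s * (c + 1)) =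
      s * (x + y * Complex.I) + d := by
    intro s d; rw [hX]; push_cast; ring
  have hu2 : ((1 : ℝ) : ℂ) * ((X : ℝ) + y * Complex.I) + (-(c : ℂ)) =
      (x + y * Complex.I) + 1 := by
    rw [hX]; push_cast; ring
  simp only [hu1] at g1 g2
  rw [hu2] at g3
  rw [wrightH, wrightCoeff, div_eq_mul_inv, ← Finset.prod_inv_distrib, norm_mul, norm_mul, norm_mul]
  refine (mul_le_mul (mul_le_mul (mul_le_mul g1 g2 (norm_nonneg _) (by positivity)) g3
    (norm_nonneg _) (by positivity)) hw' (norm_nonneg _) (by positivity)).trans ?_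
  rw [← Real.exp_add, ← Real.exp_add, ← Real.exp_add, Real.exp_le_exp]
  have hn := mul_le_mul_of_nonneg_left (neg_stE_le hX1 y) hκ0.le
  rw [Finset.sum_neg_distrib]
  have e : (∑ r, α r) * stE X y + (-∑ r, β r) * stE X y + -1 * stE X y = κ * -stE X y := by
    rw [hκ]; ring
  nlinarith

lemma wright_diff (p q : ℕ) (α : Fin p → ℝ) (a : Fin p → ℂ)
    (β : Fin q → ℝ) (b : Fin q → ℂ) (u : ℂ) (hu : ∀ r, 0 < α r * u.re + (a r).re) :
    DifferentiableAt ℂ (wrightCoeff p q α a β b) u := by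
  have : wrightCoeff p q α a β b = fun s =>
      (∏ r, Complex.Gamma ((α r : ℂ) * s + a r)) * ∏ r, (Complex.Gamma ((β r : ℂ) * s + b r))⁻¹ := by
    ext s; rw [wrightCoeff, div_eq_mul_inv, Finset.prod_inv_distrib]
  rw [this]
  refine DifferentiableAt.mul ?_ ?_
  · refine DifferentiableAt.fun_finsetProd fun r _ => ?_
    refine DifferentiableAt.comp (f := fun s : ℂ => (α r : ℂ) * s + a r) u
      (Complex.differentiableAt_Gamma _ ?_) (by fun_prop)
    intro m h
    have h2 := congrArg Complex.re h
    simp at h2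
    have := hu r
    have hm : (0 : ℝ) ≤ m := by positivity
    linarith
  · refine DifferentiableAt.fun_finsetProd fun r _ => ?_
    exact DifferentiableAt.comp (g := fun s => (Complex.Gamma s)⁻¹)
      (f := fun s : ℂ => (β r : ℂ) * s + b r) u
      (Complex.differentiable_one_div_Gamma _) (by fun_prop)

lemma wright_reflect (p q : ℕ) (α : Fin p → ℝ) (a : Fin p → ℂ)
    (β : Fin q → ℝ) (b : Fin q → ℂ) (w u : ℂ) (hu : Complex.Gamma (u + 1) ≠ 0) :
    Complex.Gamma (-u) * wrightCoeff p q α a β b u * w ^ u =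
      -(cscP u * wrightH p q α a β b w u) := by
  have h := Complex.Gamma_mul_Gamma_one_sub (-u)
  rw [sub_neg_eq_add, add_comm 1 u, mul_neg, Complex.sin_neg, div_neg] at h
  have h2 : Complex.Gamma (-u) = -cscP u * (Complex.Gamma (u + 1))⁻¹ := by
    rw [cscP, ← h]; field_simp
  rw [h2, wrightH]
  ring

/-- Mellin–Barnes integral representation of the generalised Wright function:
for `0 < κ < 2`, `Re a_r > 0`, `0 < c < min_r Re(a_r)/α_r` and `w ≠ 0` with
`|arg w| < π(1 − κ/2)`, one has
`ₚΨ_q(−w) = (1/2π) ∫_ℝ Γ(c+it) g(−(c+it)) w^{−(c+it)} dt`,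
the integrand being absolutely integrable. -/
theorem wright_mellin_barnes (p q : ℕ) (α : Fin p → ℝ) (a : Fin p → ℂ)
    (β : Fin q → ℝ) (b : Fin q → ℂ)
    (hα : ∀ r, 0 < α r) (hβ : ∀ r, 0 < β r)
    (ha : ∀ (n : ℕ) (r : Fin p) (m : ℕ), (α r : ℂ) * (n : ℂ) + a r ≠ -(m : ℂ))
    (hκ0 : 0 < 1 + ∑ r, β r - ∑ r, α r)
    (hκ2 : 1 + ∑ r, β r - ∑ r, α r < 2)
    (hare : ∀ r, 0 < (a r).re)
    (c : ℝ) (hc0 : 0 < c) (hc1 : ∀ r, c < (a r).re / α r)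
    (w : ℂ) (hw : w ≠ 0)
    (harg : |w.arg| < Real.pi * (1 - (1 + ∑ r, β r - ∑ r, α r) / 2)) :
    MeasureTheory.Integrable (fun t : ℝ =>
      Complex.Gamma ((c : ℂ) + t * Complex.I) *
        wrightCoeff p q α a β b (-((c : ℂ) + t * Complex.I)) *
        w ^ (-((c : ℂ) + t * Complex.I))) ∧
    (∑' n : ℕ, wrightCoeff p q α a β b (n : ℂ) * (-w) ^ n / (n.factorial : ℂ))
      = (1 / (2 * (Real.pi : ℂ))) *
        ∫ t : ℝ, Complex.Gamma ((c : ℂ) + t * Complex.I) *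
          wrightCoeff p q α a β b (-((c : ℂ) + t * Complex.I)) *
          w ^ (-((c : ℂ) + t * Complex.I)) := by
  set κ := 1 + ∑ r, β r - ∑ r, α r with hκ
  set δ := Real.pi * (1 - κ / 2) - |w.arg| with hδ
  have hδ0 : 0 < δ := by linarith
  obtain ⟨C, hC, hb⟩ := wrightH_bound p q α a β b hα hβ hκ0 c hc1 w hw
    (show 0 < δ / 2 by positivity)
  rw [← hκ] at hb
  set θ := Real.pi * (κ / 2) + |w.arg| + δ / 2 with hθ
  have hpi := Real.pi_pos
  have hθ0 : 0 ≤ θ := by positivity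
  have hθ1 : θ < Real.pi := by
    have : Real.pi * (1 - κ / 2) = Real.pi - Real.pi * (κ / 2) := by ring
    linarith
  set H := wrightH p q α a β b w with hH
  have hre : ∀ u : ℂ, -c ≤ u.re → ∀ r, 0 < α r * u.re + (a r).re := by
    intro u hu r
    have h1 := hc1 r
    rw [lt_div_iff₀ (hα r)] at h1
    have := mul_le_mul_of_nonneg_left hu (hα r).le
    linarith
  have hwd : Differentiable ℂ (fun u : ℂ => w ^ u) := by
    intro u
    exact (differentiableAt_id).const_cpow (Or.inl hw)
  have hd : DifferentiableOn ℂ H {u | -c < u.re} := by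
    intro u hu
    apply DifferentiableAt.differentiableWithinAt
    refine ((wright_diff p q α a β b u (hre u (le_of_lt hu))).mul ?_).mul (hwd u)
    exact DifferentiableAt.comp (g := fun s => (Complex.Gamma s)⁻¹) (f := fun s : ℂ => s + 1) u
      (Complex.differentiable_one_div_Gamma _) (by fun_prop)
  set c₀ := min c 1 / 2 with hc₀
  have hmin : 0 < min c 1 := lt_min hc0 one_pos
  have hmc := min_le_left c 1
  have hm1 := min_le_right c 1
  have hmain := contour_main hκ0 hC hθ0 hθ1 hd hb (c₀ := c₀) (by linarith) (by linarith)
    (by linarith)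
  set F : ℂ → ℂ := fun u => Complex.Gamma (-u) * wrightCoeff p q α a β b u * w ^ u with hF
  have hFd : ∀ u : ℂ, -c ≤ u.re → u.re ≤ -c₀ → DifferentiableAt ℂ F u := by
    intro u h1 h2
    refine (DifferentiableAt.mul ?_ (wright_diff p q α a β b u (hre u h1))).mul (hwd u)
    refine DifferentiableAt.comp (f := fun s : ℂ => -s) u
      (Complex.differentiableAt_Gamma _ ?_) (by fun_prop)
    intro m h
    have h3 := congrArg Complex.re h
    simp at h3
    have hm : (0 : ℝ) ≤ m := by positivity
    linarith
  have hFb : ∀ x y : ℝ, -c ≤ x → x ≤ -c₀ → 1 ≤ |y| →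
      ‖F (x + y * Complex.I)‖ ≤ (4 * Real.pi * Real.exp (C * (-c₀ + c + 1))) *
        Real.exp (-((Real.pi - θ) * |y|)) := by
    intro x y h1 h2 hy
    have hne : Complex.Gamma ((x + y * Complex.I) + 1) ≠ 0 := by
      apply Complex.Gamma_ne_zero
      intro m h
      have h3 := congrArg Complex.im h
      simp at h3
      rw [h3] at hy
      norm_num at hy
    simp only [hF]
    rw [wright_reflect p q α a β b w _ hne, norm_neg, norm_mul]
    refine (mul_le_mul (cscP_bound x y hy) (strip_bound hκ0 hC hb y h1 h2) (norm_nonneg _)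
      (by positivity)).trans (le_of_eq ?_)
    rw [show -((Real.pi - θ) * |y|) = -(Real.pi * |y|) + θ * |y| by ring, Real.exp_add]
    ring
  obtain ⟨i1, -, i3⟩ := contour_shift (by linarith : -c ≤ -c₀) hFd
    (by linarith : 0 < Real.pi - θ) hFb
  have hFH : ∀ y : ℝ, F ((-c₀ : ℝ) + y * Complex.I) =
      -(cscP ((-c₀ : ℝ) + y * Complex.I) * H ((-c₀ : ℝ) + y * Complex.I)) := by
    intro y
    apply wright_reflect
    apply Complex.Gamma_ne_zero_of_re_pos
    simp
    linarith
  have hval : ∫ y : ℝ, F ((-c : ℝ) + y * Complex.I) =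
      (2 * Real.pi) * ∑' n : ℕ, H n * (-1) ^ n := by
    rw [i3]
    simp only [hFH]
    rw [MeasureTheory.integral_neg, hmain]
    ring
  have hfun : (fun t : ℝ => Complex.Gamma ((c : ℂ) + t * Complex.I) *
      wrightCoeff p q α a β b (-((c : ℂ) + t * Complex.I)) *
      w ^ (-((c : ℂ) + t * Complex.I))) = fun t : ℝ => F ((-c : ℝ) + (-t : ℝ) * Complex.I) := by
    ext t
    have : ((-c : ℝ) : ℂ) + (-t : ℝ) * Complex.I = -((c : ℂ) + t * Complex.I) := by
      push_cast; ring
    simp only [hF]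
    rw [this, neg_neg]
  rw [hfun]
  refine ⟨i1.comp_neg, ?_⟩
  rw [MeasureTheory.integral_neg_eq_self (fun y : ℝ => F ((-c : ℝ) + y * Complex.I)), hval,
    ← mul_assoc]
  have hp : (Real.pi : ℂ) ≠ 0 := by exact_mod_cast Real.pi_ne_zero
  rw [one_div_mul_cancel (mul_ne_zero two_ne_zero hp), one_mul]
  congr 1
  ext n
  simp only [hH, wrightH]
  rw [Complex.Gamma_nat_eq_factorial, Complex.cpow_natCast, neg_pow]
  ring
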